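/- Let m ≥ 1, let b₁, …, b_n be Hermitian matrices in M = Matrix (Fin m) (Fin m) ℂ, let τ(a) = trace(a)/m, let Ψ(a) = ((τ a).re, (τ(b₁a)).re, …, (τ(b_na)).re) ∈ ℝ^{n+1}, and let B = Ψ({a ∈ M : a is positive semidefinite and 1 − a is positive semidefinite}) be the spectral scale. Then B has a finite number of extreme points (Set.Finite (extremePoints ℝ B)) if and only if the matrices b₁, …, b_n commute pairwise (bᵢ·bⱼ = bⱼ·bᵢ for all i, j). -/

import Mathlib

open ComplexOrder

/-- The map `Ψ(a) = (Re τ(a), Re τ(b₁a), …, Re τ(bₙa))`, where `τ(a) = trace(a)/m`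
is the normalized trace on `Matrix (Fin m) (Fin m) ℂ`. -/
noncomputable def spectralScaleMap {m n : ℕ} (b : Fin n → Matrix (Fin m) (Fin m) ℂ)
    (a : Matrix (Fin m) (Fin m) ℂ) : EuclideanSpace ℝ (Fin (n + 1)) :=
  (WithLp.equiv 2 (Fin (n + 1) → ℝ)).symm
    (Fin.cons ((a.trace / m).re) (fun j => (((b j * a).trace / m).re)))

/-- The matrices `a` with `0 ≤ a ≤ 1` in the Loewner order. -/
def matrixUnitInterval (m : ℕ) : Set (Matrix (Fin m) (Fin m) ℂ) :=
  {a | a.PosSemidef ∧ (1 - a).PosSemidef}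

/-- The spectral projections `χ_{(r, ∞)}(c)` of `c`, for `r` not an eigenvalue of `c`. -/
def upperSpectralProjections {m : ℕ} (c : Matrix (Fin m) (Fin m) ℂ) :
    Set (Matrix (Fin m) (Fin m) ℂ) :=
  {p | ∃ U ∈ Matrix.unitaryGroup (Fin m) ℂ, ∃ (d : Fin m → ℝ) (r : ℝ),
    c = U * Matrix.diagonal (fun k => (d k : ℂ)) * star U ∧ (∀ k, d k ≠ r) ∧
    p = U * Matrix.diagonal (fun k => if r < d k then (1 : ℂ) else 0) * star U}

namespace Matrix

theorem PosSemidef.apply_eq_zero_of_diag_eq_zero {m : ℕ} {a : Matrix (Fin m) (Fin m) ℂ}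
    (ha : a.PosSemidef) {k : Fin m} (hk : a k k = 0) (l : Fin m) : a l k = 0 := by
  have h := (ha.dotProduct_mulVec_zero_iff (Pi.single k 1)).1 (by simp [hk])
  simpa using congrFun h l

theorem PosSemidef.diag_im_eq_zero {m : ℕ} {a : Matrix (Fin m) (Fin m) ℂ}
    (ha : a.PosSemidef) (k : Fin m) : (a k k).im = 0 :=
  (Complex.le_def.1 (ha.diag_nonneg (i := k))).2.symm

theorem diag_re_mem_Icc {m : ℕ} {a : Matrix (Fin m) (Fin m) ℂ}
    (ha : a ∈ matrixUnitInterval m) (k : Fin m) : (a k k).re ∈ Set.Icc (0 : ℝ) 1 := by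
  have h1 := (Complex.le_def.1 (ha.1.diag_nonneg (i := k))).1
  have h2 := (Complex.le_def.1 (ha.2.diag_nonneg (i := k))).1
  simp at h1 h2
  exact ⟨h1, h2⟩

theorem diagonal_mem_unitInterval {m : ℕ} {x : Fin m → ℝ} (hx : ∀ k, x k ∈ Set.Icc (0 : ℝ) 1) :
    diagonal (fun k => (x k : ℂ)) ∈ matrixUnitInterval m := by
  refine ⟨PosSemidef.diagonal fun k => ?_, ?_⟩
  · simpa using (hx k).1
  · rw [← diagonal_one, diagonal_sub]
    refine PosSemidef.diagonal fun k => ?_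
    simpa [Complex.le_def] using (hx k).2

theorem star_conj_mem_unitInterval {m : ℕ} {a U : Matrix (Fin m) (Fin m) ℂ}
    (hU : U ∈ unitaryGroup (Fin m) ℂ) (ha : a ∈ matrixUnitInterval m) :
    star U * a * U ∈ matrixUnitInterval m := by
  refine ⟨ha.1.conjTranspose_mul_mul_same U, ?_⟩
  have h := ha.2.conjTranspose_mul_mul_same U
  rwa [← star_eq_conjTranspose, mul_sub, sub_mul, mul_one, mem_unitaryGroup_iff'.1 hU] at h

theorem conj_mem_unitInterval {m : ℕ} {a U : Matrix (Fin m) (Fin m) ℂ}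
    (hU : U ∈ unitaryGroup (Fin m) ℂ) (ha : a ∈ matrixUnitInterval m) :
    U * a * star U ∈ matrixUnitInterval m := by
  simpa using star_conj_mem_unitInterval (Unitary.star_mem hU) ha

theorem star_conj_conj {m : ℕ} {U : Matrix (Fin m) (Fin m) ℂ}
    (hU : U ∈ unitaryGroup (Fin m) ℂ) (a : Matrix (Fin m) (Fin m) ℂ) :
    star U * (U * a * star U) * U = a := by
  have h := mem_unitaryGroup_iff'.1 hU
  calc _ = (star U * U) * a * (star U * U) := by noncomm_ring
    _ = a := by simp [h]

theorem conj_star_conj {m : ℕ} {U : Matrix (Fin m) (Fin m) ℂ}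
    (hU : U ∈ unitaryGroup (Fin m) ℂ) (a : Matrix (Fin m) (Fin m) ℂ) :
    U * (star U * a * U) * star U = a := by
  simpa using star_conj_conj (Unitary.star_mem hU) a

theorem conj_mul_conj {m : ℕ} {U : Matrix (Fin m) (Fin m) ℂ}
    (hU : U ∈ unitaryGroup (Fin m) ℂ) (a b : Matrix (Fin m) (Fin m) ℂ) :
    (U * a * star U) * (U * b * star U) = U * (a * b) * star U := by
  have h := mem_unitaryGroup_iff'.1 hU
  calc _ = U * a * (star U * U) * b * star U := by noncomm_ring
    _ = _ := by rw [h]; noncomm_ring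

theorem trace_conj_diagonal_mul {m : ℕ} (U a : Matrix (Fin m) (Fin m) ℂ) (d : Fin m → ℂ) :
    (U * diagonal d * star U * a).trace = ∑ k, d k * (star U * a * U) k k := by
  have : (U * diagonal d * star U * a).trace = (diagonal d * (star U * a * U)).trace := by
    rw [mul_assoc, mul_assoc, trace_mul_comm, mul_assoc, mul_assoc]
  rw [this]
  simp [trace, diagonal_mul]

theorem trace_eq_sum_conj {m : ℕ} {U : Matrix (Fin m) (Fin m) ℂ}
    (hU : U ∈ unitaryGroup (Fin m) ℂ) (a : Matrix (Fin m) (Fin m) ℂ) :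
    a.trace = ∑ k, (star U * a * U) k k := by
  simpa [mem_unitaryGroup_iff.1 hU] using trace_conj_diagonal_mul U a (fun _ => 1)

/-- On the unit interval, `e ↦ ∑ k, d k * e k k` with all `d k ≠ 0` has a unique maximizer. -/
theorem eq_diagonal_of_sum_le {m : ℕ} {e : Matrix (Fin m) (Fin m) ℂ}
    (he : e ∈ matrixUnitInterval m) {d : Fin m → ℝ} (hd : ∀ k, d k ≠ 0)
    (h : ∑ k, (if 0 < d k then d k else 0) ≤ ∑ k, d k * (e k k).re) :
    e = diagonal (fun k => if 0 < d k then (1 : ℂ) else 0) := by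
  have hle : ∀ k ∈ Finset.univ, d k * (e k k).re ≤ if 0 < d k then d k else 0 := by
    intro k _
    obtain ⟨h0, h1⟩ := diag_re_mem_Icc he k
    split_ifs with hk <;> nlinarith
  have heq := (Finset.sum_eq_sum_iff_of_le hle).1 (le_antisymm (Finset.sum_le_sum hle) h)
  ext l k
  have hk := heq k (Finset.mem_univ k)
  have him := he.1.diag_im_eq_zero k
  split_ifs at hk with hpos
  · have hone : e k k = 1 :=
      Complex.ext (mul_left_cancel₀ (hd k) (by simpa using hk)) (by simpa using him)
    have := he.2.apply_eq_zero_of_diag_eq_zero (k := k) (by simp [hone]) l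
    rw [sub_apply, sub_eq_zero] at this
    rw [← this]
    by_cases hlk : l = k
    · subst hlk; simp [hpos]
    · simp [hlk]
  · have hzero : e k k = 0 :=
      Complex.ext (by simpa [hd k] using hk) (by simpa using him)
    rw [he.1.apply_eq_zero_of_diag_eq_zero hzero l]
    by_cases hlk : l = k
    · subst hlk; simp [hpos]
    · simp [hlk]

theorem mem_unitInterval_of_mem_upperSpectralProjections {m : ℕ}
    {c p : Matrix (Fin m) (Fin m) ℂ} (hp : p ∈ upperSpectralProjections c) :
    p ∈ matrixUnitInterval m := by
  obtain ⟨U, hU, d, r, -, -, rfl⟩ := hp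
  refine conj_mem_unitInterval hU ?_
  have := diagonal_mem_unitInterval (x := fun k => if r < d k then (1 : ℝ) else 0)
    (fun k => by split_ifs <;> simp)
  convert this using 3 with k
  split_ifs <;> simp

theorem commute_of_mem_upperSpectralProjections {m : ℕ}
    {c p : Matrix (Fin m) (Fin m) ℂ} (hp : p ∈ upperSpectralProjections c) : Commute p c := by
  obtain ⟨U, hU, d, r, rfl, -, rfl⟩ := hp
  rw [Commute, SemiconjBy, conj_mul_conj hU, conj_mul_conj hU, (commute_diagonal _ _).eq]

/-- `χ_{(r, ∞)}(c)` is the unique maximizer of `a ↦ tr ((c - r) a)` on the unit interval. -/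
theorem exists_unique_maximizer_of_mem_upperSpectralProjections {m : ℕ}
    {c p : Matrix (Fin m) (Fin m) ℂ} (hp : p ∈ upperSpectralProjections c) :
    ∃ r : ℝ, ∀ a ∈ matrixUnitInterval m,
      (c * p).trace.re - r * p.trace.re ≤ (c * a).trace.re - r * a.trace.re → a = p := by
  obtain ⟨U, hU, d, r, rfl, hr, rfl⟩ := hp
  have key : ∀ a, (U * diagonal (fun k => (d k : ℂ)) * star U * a).trace.re - r * a.trace.re
      = ∑ k, (d k - r) * ((star U * a * U) k k).re := by
    intro a
    rw [trace_conj_diagonal_mul, trace_eq_sum_conj hU a]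
    simp [sub_mul, Finset.sum_sub_distrib, Finset.mul_sum]
  refine ⟨r, fun a ha h => ?_⟩
  rw [key, key, star_conj_conj hU] at h
  rw [← conj_star_conj hU a, eq_diagonal_of_sum_le (star_conj_mem_unitInterval hU ha)
    (fun k => sub_ne_zero.2 (hr k)) (le_trans (Finset.sum_le_sum fun k _ => ?_) h)]
  · simp only [sub_pos]
  · by_cases hk : r < d k <;> simp [hk]

/-- A matrix commuting with the spectral projections of a Hermitian matrix commutes with it. -/
theorem commute_of_forall_upperSpectralProjections {m : ℕ} {c x : Matrix (Fin m) (Fin m) ℂ}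
    (hc : c.IsHermitian) (h : ∀ p ∈ upperSpectralProjections c, Commute x p) : Commute x c := by
  obtain ⟨U, hU, d, rfl⟩ : ∃ U ∈ unitaryGroup (Fin m) ℂ, ∃ d : Fin m → ℝ,
      c = U * diagonal (fun k => (d k : ℂ)) * star U :=
    ⟨hc.eigenvectorUnitary, hc.eigenvectorUnitary.2, hc.eigenvalues, hc.spectral_theorem⟩
  rw [← conj_star_conj hU x] at h ⊢
  set y := star U * x * U
  suffices hy : Commute y (diagonal (fun k => (d k : ℂ))) by
    rw [Commute, SemiconjBy, conj_mul_conj hU, conj_mul_conj hU, hy.eq]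
  have hoff : ∀ k l, d k ≠ d l → y k l = 0 := by
    intro k l hkl
    obtain ⟨r, hr, hrd⟩ := ((Set.Ioo_infinite (min_lt_max.2 hkl)).sdiff
      (Set.finite_range d)).nonempty
    have hcomm := h _ ⟨U, hU, d, r, rfl, fun k hk => hrd ⟨k, hk⟩, rfl⟩
    have heq := congrArg (fun z => star U * z * U) hcomm.eq
    simp only [conj_mul_conj hU, star_conj_conj hU] at heq
    have hkl' := congrFun (congrFun heq k) l
    rw [mul_diagonal, diagonal_mul] at hkl'
    obtain ⟨h1, h2⟩ := hr
    rcases lt_or_gt_of_ne hkl with hlt | hlt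
    · rw [min_eq_left hlt.le] at h1
      rw [max_eq_right hlt.le] at h2
      simpa [h1.not_gt, h2] using hkl'
    · rw [min_eq_right hlt.le] at h1
      rw [max_eq_left hlt.le] at h2
      simpa [h1.not_gt, h2, eq_comm] using hkl'
  ext k l
  rw [mul_diagonal, diagonal_mul]
  by_cases hkl : d k = d l
  · rw [hkl, mul_comm]
  · simp [hoff k l hkl]

set_option maxHeartbeats 1000000 in
/-- Commuting Hermitian matrices are simultaneously unitarily diagonalizable. -/
theorem exists_simultaneous_diagonalization {m n : ℕ} {b : Fin n → Matrix (Fin m) (Fin m) ℂ}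
    (hb : ∀ i, (b i).IsHermitian) (hcomm : ∀ i j, b i * b j = b j * b i) :
    ∃ U ∈ unitaryGroup (Fin m) ℂ, ∃ d : Fin n → Fin m → ℂ,
      ∀ j, b j = U * diagonal (d j) * star U := by
  classical
  let T : Fin n → Module.End ℂ (EuclideanSpace ℂ (Fin m)) := fun j => (b j).toEuclideanLin
  have hT : ∀ j, (T j).IsSymmetric := fun j => isSymmetric_toEuclideanLin_iff.2 (hb j)
  have hC : Pairwise (Function.onFun Commute T) := by
    intro i j _
    ext x : 1
    simp [T, toLpLin_apply, hcomm i j]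
  let V : (Fin n → ℂ) → Submodule ℂ (EuclideanSpace ℂ (Fin m)) :=
    fun χ => ⨅ j, Module.End.eigenspace (T j) (χ j)
  have hV : DirectSum.IsInternal V :=
    LinearMap.IsSymmetric.directSum_isInternal_of_pairwise_commute hT hC
  have hfin : {χ | V χ ≠ ⊥}.Finite :=
    WellFoundedGT.finite_ne_bot_of_iSupIndep hV.submodule_iSupIndep
  have : Fintype {χ // V χ ≠ ⊥} := hfin.fintype
  have hV' := DirectSum.isInternal_ne_bot_iff.2 hV
  have hO : OrthogonalFamily ℂ (fun χ : {χ // V χ ≠ ⊥} => V χ) fun χ => (V χ).subtypeₗᵢ :=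
    (LinearMap.IsSymmetric.orthogonalFamily_iInf_eigenspaces hT).comp Subtype.val_injective
  let v := hV'.subordinateOrthonormalBasis finrank_euclideanSpace_fin hO
  let χ := fun k => (hV'.subordinateOrthonormalBasisIndex finrank_euclideanSpace_fin k hO).1
  have hv : ∀ j k, T j (v k) = χ k j • v k := by
    intro j k
    have := hV'.subordinateOrthonormalBasis_subordinate finrank_euclideanSpace_fin k hO
    exact Module.End.mem_eigenspace_iff.1 ((Submodule.mem_iInf _).1 this j)
  let U := (EuclideanSpace.basisFun (Fin m) ℂ).toBasis.toMatrix v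
  have hU : U ∈ unitaryGroup (Fin m) ℂ :=
    (EuclideanSpace.basisFun (Fin m) ℂ).toMatrix_orthonormalBasis_mem_unitary v
  refine ⟨U, hU, fun j k => χ k j, fun j => ?_⟩
  have hbU : b j * U = U * diagonal (fun k => χ k j) := by
    ext l k
    have h := congrArg (fun w => w.ofLp l) (hv j k)
    rw [mul_diagonal]
    simpa [T, U, toLpLin_apply, mul_apply, mulVec, dotProduct, Module.Basis.toMatrix_apply,
      mul_comm] using h
  rw [← hbU, mul_assoc, mem_unitaryGroup_iff.1 hU, mul_one]

end Matrix

open Matrix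

theorem finite_extremePoints_spectralScale_of_commute {m n : ℕ}
    {b : Fin n → Matrix (Fin m) (Fin m) ℂ} (hb : ∀ i, (b i).IsHermitian)
    (hcomm : ∀ i j, b i * b j = b j * b i) :
    (Set.extremePoints ℝ (spectralScaleMap b '' matrixUnitInterval m)).Finite := by
  obtain ⟨U, hU, d, hd⟩ := exists_simultaneous_diagonalization hb hcomm
  have hdreal : ∀ j k, (d j k).im = 0 := by
    intro j k
    have h := isHermitian_conjTranspose_mul_mul U (hb j)
    rw [← star_eq_conjTranspose, hd j, star_conj_conj hU] at h
    have h' := h.apply k k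
    rw [diagonal_apply_eq] at h'
    exact Complex.conj_eq_iff_im.1 h'
  let L : (Fin m → ℝ) →ₗ[ℝ] EuclideanSpace ℝ (Fin (n + 1)) :=
    { toFun := fun x => (WithLp.equiv 2 (Fin (n + 1) → ℝ)).symm
        (Fin.cons ((∑ k, x k) / m) (fun j => (∑ k, (d j k).re * x k) / m))
      map_add' := fun x y => by
        ext i
        refine Fin.cases ?_ (fun j => ?_) i <;> simp [Finset.sum_add_distrib, mul_add, add_div]
      map_smul' := fun t x => by
        ext i
        refine Fin.cases ?_ (fun j => ?_) i <;>
          simp [Finset.mul_sum, mul_div_assoc, mul_left_comm, Finset.sum_div] }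
  have hL : ∀ a, spectralScaleMap b a = L (fun k => ((star U * a * U) k k).re) := by
    intro a
    ext i
    refine Fin.cases ?_ (fun j => ?_) i
    · simp [spectralScaleMap, L, trace_eq_sum_conj hU a]
    · have := trace_conj_diagonal_mul U a (d j)
      rw [← hd j] at this
      simp [spectralScaleMap, L, this, hdreal]
  have himage : spectralScaleMap b '' matrixUnitInterval m
      = convexHull ℝ (L '' Set.univ.pi fun _ => {0, 1}) := by
    rw [← LinearMap.image_convexHull, convexHull_pi]
    simp only [convexHull_pair, segment_eq_Icc zero_le_one]
    apply Set.Subset.antisymm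
    · rintro _ ⟨a, ha, rfl⟩
      exact ⟨_, fun k _ => diag_re_mem_Icc (star_conj_mem_unitInterval hU ha) k, (hL a).symm⟩
    · rintro _ ⟨x, hx, rfl⟩
      refine ⟨_, conj_mem_unitInterval hU
        (diagonal_mem_unitInterval fun k => hx k (Set.mem_univ k)), ?_⟩
      rw [hL, star_conj_conj hU]
      simp
  rw [himage]
  exact ((Set.Finite.pi fun _ => Set.toFinite _).image L).subset extremePoints_convexHull_subset

/-- The points of the unit interval that are the only preimage of an extreme point of the
spectral scale. -/
def uniquelyExtreme {m n : ℕ} (b : Fin n → Matrix (Fin m) (Fin m) ℂ) :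
    Set (Matrix (Fin m) (Fin m) ℂ) :=
  {p | p ∈ matrixUnitInterval m ∧
    spectralScaleMap b p ∈ Set.extremePoints ℝ (spectralScaleMap b '' matrixUnitInterval m) ∧
    ∀ a ∈ matrixUnitInterval m, spectralScaleMap b a = spectralScaleMap b p → a = p}

theorem upperSpectralProjections_subset_uniquelyExtreme {m n : ℕ} (hm : 1 ≤ m)
    (b : Fin n → Matrix (Fin m) (Fin m) ℂ) (i j : Fin n) (s : ℝ) :
    upperSpectralProjections (b i + (s : ℂ) • b j) ⊆ uniquelyExtreme b := by
  intro p hp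
  have hpI := mem_unitInterval_of_mem_upperSpectralProjections hp
  obtain ⟨r, hr⟩ := exists_unique_maximizer_of_mem_upperSpectralProjections hp
  have hm0 : (m : ℝ) ≠ 0 := by positivity
  let φ : EuclideanSpace ℝ (Fin (n + 1)) → ℝ := fun y => m * (y i.succ + s * y j.succ - r * y 0)
  have hφ : ∀ a, φ (spectralScaleMap b a)
      = ((b i + (s : ℂ) • b j) * a).trace.re - r * a.trace.re := by
    intro a
    simp [φ, spectralScaleMap, add_mul]
    field_simp
  simp only [← hφ] at hr
  have hle : ∀ a ∈ matrixUnitInterval m, φ (spectralScaleMap b a) ≤ φ (spectralScaleMap b p) := by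
    intro a ha
    by_contra! h
    rw [hr a ha h.le] at h
    exact lt_irrefl _ h
  refine ⟨hpI, mem_extremePoints.2 ⟨⟨p, hpI, rfl⟩, ?_⟩, fun a ha h => hr a ha (by rw [h])⟩
  rintro _ ⟨a₁, h₁, rfl⟩ _ ⟨a₂, h₂, rfl⟩ ⟨u, w, hu, hw, huw, h⟩
  have hsum : φ (spectralScaleMap b p)
      = u * φ (spectralScaleMap b a₁) + w * φ (spectralScaleMap b a₂) := by
    rw [← h]
    simp only [φ, PiLp.add_apply, PiLp.smul_apply, smul_eq_mul]
    ring
  have e₁ := hle a₁ h₁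
  have e₂ := hle a₂ h₂
  obtain rfl : w = 1 - u := by linarith
  rw [hr a₁ h₁ (by nlinarith), hr a₂ h₂ (by nlinarith)]
  exact ⟨rfl, rfl⟩

theorem commute_of_finite_extremePoints_spectralScale {m n : ℕ} (hm : 1 ≤ m)
    {b : Fin n → Matrix (Fin m) (Fin m) ℂ} (hb : ∀ i, (b i).IsHermitian)
    (hfin : (Set.extremePoints ℝ (spectralScaleMap b '' matrixUnitInterval m)).Finite)
    (i j : Fin n) : b i * b j = b j * b i := by
  have hP : (uniquelyExtreme b).Finite :=
    Set.Finite.of_finite_image (hfin.subset (Set.image_subset_iff.2 fun p hp => hp.2.1))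
      fun p hp q hq h => hq.2.2 p hp.1 h
  have : Finite (𝒫 uniquelyExtreme b) := hP.finite_subsets.to_subtype
  let c : ℕ → Matrix (Fin m) (Fin m) ℂ := fun s => b i + (((s : ℕ) : ℝ) : ℂ) • b j
  obtain ⟨s, t, hst, h⟩ := Finite.exists_ne_map_eq_of_infinite
    (fun s : ℕ => (⟨upperSpectralProjections (c s),
      upperSpectralProjections_subset_uniquelyExtreme hm b i j s⟩ : 𝒫 uniquelyExtreme b))
  replace h : upperSpectralProjections (c s) = upperSpectralProjections (c t) :=
    congrArg Subtype.val h
  have hsub : ((s : ℂ) - t) ≠ 0 := sub_ne_zero.2 (by exact_mod_cast hst)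
  have hdiff : b j = ((s : ℂ) - t)⁻¹ • (c s - c t) := by
    simp only [c, Complex.ofReal_natCast, add_sub_add_left_eq_sub, ← sub_smul, smul_smul,
      inv_mul_cancel₀ hsub, one_smul]
  have hcomm : Commute (b j) (c s) := by
    refine commute_of_forall_upperSpectralProjections ?_ fun p hp => ?_
    · refine (hb i).add ((hb j).smul ?_)
      simp [IsSelfAdjoint]
    · rw [hdiff]
      exact ((commute_of_mem_upperSpectralProjections hp).symm.sub_left
        (commute_of_mem_upperSpectralProjections (h ▸ hp)).symm).smul_left _
  have hbi : b i = c s - (((s : ℕ) : ℝ) : ℂ) • b j := by simp [c]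
  rw [hbi]
  exact (hcomm.sub_right ((Commute.refl (b j)).smul_right _)).symm.eq

theorem stmt12 {m n : ℕ} (hm : 1 ≤ m) (b : Fin n → Matrix (Fin m) (Fin m) ℂ)
    (hb : ∀ i, (b i).IsHermitian)
    (B : Set (EuclideanSpace ℝ (Fin (n + 1))))
    (hB : B = spectralScaleMap b ''
      {a : Matrix (Fin m) (Fin m) ℂ | a.PosSemidef ∧ (1 - a).PosSemidef}) :
    (Set.extremePoints ℝ B).Finite ↔ ∀ i j, b i * b j = b j * b i := by
  subst hB
  exact ⟨fun h => commute_of_finite_extremePoints_spectralScale hm hb h,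
    fun h => finite_extremePoints_spectralScale_of_commute hb h⟩
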